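/- Fix an integer k ≥ 3 and a real σ with 0 < σ < 2^{−k}. There exist γ ∈ (0,1), c > 0 and N such that for all n ≥ N, the number of H ∈ B_n that are γ-equitable but not σ-standard is at most |B_n| · 2^{−c·n^{k−1}}. -/

import Mathlib

open Finset

/-- `H` is a `k`-graph on `[n]`: every edge is a `k`-element subset. -/
def IsKGraph (n k : ℕ) (H : Finset (Finset (Fin n))) : Prop :=
  ∀ e ∈ H, e.card = k

/-- `X, Y` is a bipartition of the hypergraph `H` on `[n]`. -/
def IsBipartition (n : ℕ) (H : Finset (Finset (Fin n))) (X Y : Finset (Fin n)) : Prop :=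
  Disjoint X Y ∧ X ∪ Y = Finset.univ ∧ ∀ e ∈ H, ¬ e ⊆ X ∧ ¬ e ⊆ Y

/-- `B_n`: the collection of all bipartite `k`-graphs on `[n]`. -/
def Bip (n k : ℕ) : Set (Finset (Finset (Fin n))) :=
  {H | IsKGraph n k H ∧ ∃ X Y : Finset (Fin n), IsBipartition n H X Y}

/-- `K[X,Y]`: the crossing `k`-sets, i.e. those contained neither in `X` nor in `Y`. -/
def crossing (n k : ℕ) (X Y : Finset (Fin n)) : Finset (Finset (Fin n)) :=
  (Finset.univ.powersetCard k).filter fun e => ¬ e ⊆ X ∧ ¬ e ⊆ Y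

/-- joint `H`-degree of `u` and `v`: the number of `(k-1)`-sets `J ⊆ [n] \ {u,v}`
with `{u} ∪ J ∈ H` and `{v} ∪ J ∈ H`. -/
def jointDeg (n k : ℕ) (H : Finset (Finset (Fin n))) (u v : Fin n) : ℕ :=
  (((Finset.univ \ {u, v}).powersetCard (k - 1)).filter
    fun J => insert u J ∈ H ∧ insert v J ∈ H).card

/-- `deg_H(v, U)`: the number of `(k-1)`-sets `J ⊆ U \ {v}` with `{v} ∪ J ∈ H`. -/
def degIn (n k : ℕ) (H : Finset (Finset (Fin n))) (v : Fin n) (U : Finset (Fin n)) : ℕ :=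
  (((U \ {v}).powersetCard (k - 1)).filter fun J => insert v J ∈ H).card

/-- `e_{H_J}(A, B)`: for disjoint `A`, `B`, the number of link-graph edges of `H_J`
with one endpoint in `A` and one in `B`. -/
def linkBetween (n : ℕ) (H : Finset (Finset (Fin n))) (J A B : Finset (Fin n)) : ℕ :=
  ((A ×ˢ B).filter fun p => p.1 ∉ J ∧ p.2 ∉ J ∧ insert p.1 (insert p.2 J) ∈ H).card

/-- `e_{H_J}(A)`: the number of link-graph edges of `H_J` contained in `A`. -/
def linkWithin (n : ℕ) (H : Finset (Finset (Fin n))) (J A : Finset (Fin n)) : ℕ :=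
  ((A.powersetCard 2).filter fun p => Disjoint p J ∧ p ∪ J ∈ H).card

/-- The bipartition `X, Y` is `σ`-standard w.r.t. `H`. -/
def SigmaStandardWrt (n k : ℕ) (σ : ℝ) (H : Finset (Finset (Fin n)))
    (X Y : Finset (Fin n)) : Prop :=
  ∀ u v : Fin n, u ≠ v →
    (((u ∈ X ∧ v ∈ X) ∨ (u ∈ Y ∧ v ∈ Y)) →
      |(jointDeg n k H u v : ℝ) -
          (1 / 4 : ℝ) * (n.choose (k - 1) : ℝ) * (1 - (2 : ℝ) ^ (1 - (k : ℤ)))|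
        ≤ σ * ((1 / 4 : ℝ) * (n.choose (k - 1) : ℝ))) ∧
    (¬ ((u ∈ X ∧ v ∈ X) ∨ (u ∈ Y ∧ v ∈ Y)) →
      |(jointDeg n k H u v : ℝ) -
          (1 / 4 : ℝ) * (n.choose (k - 1) : ℝ) * (1 - (2 : ℝ) ^ (2 - (k : ℤ)))|
        ≤ σ * ((1 / 4 : ℝ) * (n.choose (k - 1) : ℝ)))

/-- `H` is `σ`-standard: every bipartition of `H` is `σ`-standard w.r.t. `H`. -/
def SigmaStandard (n k : ℕ) (σ : ℝ) (H : Finset (Finset (Fin n))) : Prop :=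
  ∀ X Y : Finset (Fin n), IsBipartition n H X Y → SigmaStandardWrt n k σ H X Y

/-- `H` is `γ`-equitable: every bipartition of `H` is nearly balanced. -/
def GammaEquitable (n : ℕ) (γ : ℝ) (H : Finset (Finset (Fin n))) : Prop :=
  ∀ X Y : Finset (Fin n), IsBipartition n H X Y →
    ((1 - γ) * n / 2 ≤ (X.card : ℝ) ∧ (X.card : ℝ) ≤ (1 + γ) * n / 2) ∧
    ((1 - γ) * n / 2 ≤ (Y.card : ℝ) ∧ (Y.card : ℝ) ≤ (1 + γ) * n / 2)

section BinomialTail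

variable {α ι : Type*} [DecidableEq α] [DecidableEq ι]

/-- The generating function, over all subsets `H` of `K`, of the number of pairs `{a J, b J}`
contained in `H`, for a family of disjoint pairs in `K`. -/
theorem sum_powerset_pow_card_pairs (M : Finset ι) (a b : ι → α) (K : Finset α)
    (hK : ∀ J ∈ M, a J ∈ K ∧ b J ∈ K) (ha : Set.InjOn a M) (hb : Set.InjOn b M)
    (hab : ∀ J ∈ M, ∀ J' ∈ M, a J ≠ b J') (z : ℝ) :
    ∑ H ∈ K.powerset, z ^ #{J ∈ M | a J ∈ H ∧ b J ∈ H} = 2 ^ #K * ((3 + z) / 4) ^ #M := by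
  induction M using Finset.induction_on generalizing K with
  | empty => simp
  | insert J M hJ ih =>
    obtain ⟨haK, hbK⟩ := hK J (mem_insert_self _ _)
    have hne : a J ≠ b J := hab J (mem_insert_self _ _) J (mem_insert_self _ _)
    have haM : ∀ J' ∈ M, a J' ≠ a J := fun J' hJ' h => by
      rw [ha (by simp [hJ']) (by simp) h] at hJ'; exact hJ hJ'
    have hbM : ∀ J' ∈ M, b J' ≠ b J := fun J' hJ' h => by
      rw [hb (by simp [hJ']) (by simp) h] at hJ'; exact hJ hJ'
    have habM : ∀ J' ∈ M, a J' ≠ b J := fun J' hJ' =>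
      hab J' (mem_insert_of_mem hJ') J (mem_insert_self _ _)
    have hbaM : ∀ J' ∈ M, b J' ≠ a J := fun J' hJ' =>
      (hab J (mem_insert_self _ _) J' (mem_insert_of_mem hJ')).symm
    obtain ⟨K', hbK', haK', rfl⟩ : ∃ K', b J ∉ K' ∧ a J ∉ insert (b J) K' ∧
        K = insert (a J) (insert (b J) K') :=
      ⟨(K.erase (a J)).erase (b J), by simp, by simp [hne], by
        rw [insert_erase (mem_erase.2 ⟨hne.symm, hbK⟩), insert_erase haK]⟩
    have haK'' : a J ∉ K' := fun h => haK' (mem_insert_of_mem h)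
    have hih := ih K' (fun J' hJ' => by
        have := hK J' (mem_insert_of_mem hJ')
        simpa [haM J' hJ', hbM J' hJ', habM J' hJ', hbaM J' hJ'] using this)
      (ha.mono (by simp)) (hb.mono (by simp))
      (fun J₁ h₁ J₂ h₂ => hab J₁ (mem_insert_of_mem h₁) J₂ (mem_insert_of_mem h₂))
    rw [sum_powerset_insert haK', sum_powerset_insert hbK', sum_powerset_insert hbK',
      ← sum_add_distrib, ← sum_add_distrib, ← sum_add_distrib]
    have key : ∀ H ∈ K'.powerset,
        z ^ #{J' ∈ insert J M | a J' ∈ H ∧ b J' ∈ H} +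
          z ^ #{J' ∈ insert J M | a J' ∈ insert (b J) H ∧ b J' ∈ insert (b J) H} +
          (z ^ #{J' ∈ insert J M | a J' ∈ insert (a J) H ∧ b J' ∈ insert (a J) H} +
          z ^ #{J' ∈ insert J M | a J' ∈ insert (a J) (insert (b J) H) ∧
            b J' ∈ insert (a J) (insert (b J) H)}) =
        (3 + z) * z ^ #{J' ∈ M | a J' ∈ H ∧ b J' ∈ H} := by
      intro H hH
      have haH : a J ∉ H := fun h => haK'' (mem_powerset.1 hH h)
      have hbH : b J ∉ H := fun h => hbK' (mem_powerset.1 hH h)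
      have e₁ : {J' ∈ M | a J' ∈ insert (b J) H ∧ b J' ∈ insert (b J) H} =
          {J' ∈ M | a J' ∈ H ∧ b J' ∈ H} :=
        filter_congr fun J' hJ' => by simp [hbM J' hJ', habM J' hJ']
      have e₂ : {J' ∈ M | a J' ∈ insert (a J) H ∧ b J' ∈ insert (a J) H} =
          {J' ∈ M | a J' ∈ H ∧ b J' ∈ H} :=
        filter_congr fun J' hJ' => by simp [haM J' hJ', hbaM J' hJ']
      have e₃ : {J' ∈ M | a J' ∈ insert (a J) (insert (b J) H) ∧
            b J' ∈ insert (a J) (insert (b J) H)} = {J' ∈ M | a J' ∈ H ∧ b J' ∈ H} :=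
        filter_congr fun J' hJ' => by
          simp [haM J' hJ', hbM J' hJ', habM J' hJ', hbaM J' hJ']
      rw [filter_insert, filter_insert, filter_insert, filter_insert, e₁, e₂, e₃,
        if_neg (by simp [haH]), if_neg (by simp [haH, hne]), if_neg (by simp [hbH, hne.symm]),
        if_pos (by simp), card_insert_of_notMem (by simp [hJ])]
      ring
    rw [sum_congr rfl key, ← mul_sum, hih, card_insert_of_notMem haK', card_insert_of_notMem hbK',
      card_insert_of_notMem hJ]
    ring

theorem three_add_exp_div_four_le {x : ℝ} (hx : |x| ≤ 1) :
    (3 + Real.exp x) / 4 ≤ Real.exp (x / 4 + x ^ 2 / 4) := by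
  have h₁ := (abs_le.1 (Real.abs_exp_sub_one_sub_id_le hx)).2
  have h₂ := Real.add_one_le_exp (x / 4 + x ^ 2 / 4)
  linarith

/-- A Chernoff bound: the number of pairs contained in a uniformly random subset of `K` is
concentrated around its mean `#M / 4`. -/
theorem card_filter_pairs_deviation_le (M : Finset ι) (a b : ι → α) (K : Finset α)
    (hK : ∀ J ∈ M, a J ∈ K ∧ b J ∈ K) (ha : Set.InjOn a M) (hb : Set.InjOn b M)
    (hab : ∀ J ∈ M, ∀ J' ∈ M, a J ≠ b J') {l t : ℝ} (hl₀ : 0 ≤ l) (hl₁ : l ≤ 1) :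
    (#{H ∈ K.powerset | t < |(#{J ∈ M | a J ∈ H ∧ b J ∈ H} : ℝ) - #M / 4|} : ℝ) ≤
      2 * Real.exp (l ^ 2 * #M / 4 - l * t) * 2 ^ #K := by
  have mgf : ∀ x : ℝ, |x| ≤ 1 →
      ∑ H ∈ K.powerset, Real.exp (x * ((#{J ∈ M | a J ∈ H ∧ b J ∈ H} : ℝ) - #M / 4)) ≤
        Real.exp (x ^ 2 * #M / 4) * 2 ^ #K := by
    intro x hx
    have h₁ : ∀ H ∈ K.powerset,
        Real.exp (x * ((#{J ∈ M | a J ∈ H ∧ b J ∈ H} : ℝ) - #M / 4)) =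
        Real.exp (-(x * #M / 4)) * Real.exp x ^ #{J ∈ M | a J ∈ H ∧ b J ∈ H} := by
      intro H _
      rw [← Real.exp_nat_mul, ← Real.exp_add]
      congr 1
      ring
    rw [sum_congr rfl h₁, ← mul_sum, sum_powerset_pow_card_pairs M a b K hK ha hb hab]
    calc _ ≤ Real.exp (-(x * #M / 4)) * (2 ^ #K * Real.exp (x / 4 + x ^ 2 / 4) ^ #M) := by
          have := three_add_exp_div_four_le hx
          gcongr
      _ = Real.exp (-(x * #M / 4)) * Real.exp (x / 4 + x ^ 2 / 4) ^ #M * 2 ^ #K := by ring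
      _ = _ := by
          rw [← Real.exp_nat_mul, ← Real.exp_add]
          congr 2
          ring
  set d : Finset α → ℝ := fun H => (#{J ∈ M | a J ∈ H ∧ b J ∈ H} : ℝ) - #M / 4
  have hl : |l| ≤ 1 := by rwa [abs_of_nonneg hl₀]
  calc (#{H ∈ K.powerset | t < |d H|} : ℝ) = ∑ H ∈ K.powerset with t < |d H|, (1 : ℝ) := by simp
    _ ≤ ∑ H ∈ K.powerset with t < |d H|,
          Real.exp (-(l * t)) * (Real.exp (l * d H) + Real.exp (-l * d H)) := by
        refine sum_le_sum fun H hH => ?_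
        have ht := (mem_filter.1 hH).2
        rw [mul_add, ← Real.exp_add, ← Real.exp_add]
        rcases lt_abs.1 ht with h | h
        · have : 1 ≤ Real.exp (-(l * t) + l * d H) := Real.one_le_exp (by nlinarith)
          linarith [Real.exp_pos (-(l * t) + -l * d H)]
        · have : 1 ≤ Real.exp (-(l * t) + -l * d H) := Real.one_le_exp (by nlinarith)
          linarith [Real.exp_pos (-(l * t) + l * d H)]
    _ ≤ ∑ H ∈ K.powerset,
          Real.exp (-(l * t)) * (Real.exp (l * d H) + Real.exp (-l * d H)) :=
        sum_le_sum_of_subset_of_nonneg (filter_subset _ _) fun _ _ _ => by positivity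
    _ = Real.exp (-(l * t)) * (∑ H ∈ K.powerset, Real.exp (l * d H) +
          ∑ H ∈ K.powerset, Real.exp (-l * d H)) := by rw [← mul_sum, sum_add_distrib]
    _ ≤ Real.exp (-(l * t)) * (Real.exp (l ^ 2 * #M / 4) * 2 ^ #K +
          Real.exp ((-l) ^ 2 * #M / 4) * 2 ^ #K) := by
        have := mgf l hl
        have := mgf (-l) (by rwa [abs_neg])
        gcongr
    _ = 2 * (Real.exp (l ^ 2 * #M / 4) * Real.exp (-(l * t))) * 2 ^ #K := by
        rw [neg_sq]; ring
    _ = _ := by rw [← Real.exp_add, ← sub_eq_add_neg]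

end BinomialTail

section Binomials

open Filter Topology

theorem tendsto_choose_div_pow (r : ℕ) :
    Tendsto (fun n : ℕ => (n.choose r : ℝ) / (n : ℝ) ^ r) atTop (𝓝 (1 / (r.factorial : ℝ))) := by
  have h : Tendsto (fun n : ℕ => (n.choose r : ℝ) / (n ^ r / r.factorial : ℝ)) atTop (𝓝 1) :=
    (Asymptotics.isEquivalent_iff_tendsto_one (by
      filter_upwards [eventually_gt_atTop 0] with n hn
      positivity)).1 (isEquivalent_choose r)
  refine (h.div_const (r.factorial : ℝ)).congr fun n => ?_
  field_simp

/-- Binomial coefficients `C(x, r)` with `x ≈ θ n` satisfy `C(x, r) ≈ θ ^ r C(n, r)`. -/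
theorem exists_choose_near (r : ℕ) {θ ε : ℝ} (hθ : 0 < θ) (hε : 0 < ε) :
    ∃ δ > 0, ∃ N : ℕ, ∀ n ≥ N, ∀ x : ℕ, |(x : ℝ) - θ * n| ≤ δ * n →
      |(x.choose r : ℝ) - θ ^ r * n.choose r| ≤ ε * n.choose r := by
  set L : Filter (ℕ × ℕ) := comap Prod.fst atTop ⊓
    comap (fun p : ℕ × ℕ => (p.2 : ℝ) / p.1) (𝓝 θ)
  have h₁ : Tendsto (Prod.fst : ℕ × ℕ → ℕ) L atTop := tendsto_comap.mono_left inf_le_left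
  have hq : Tendsto (fun p : ℕ × ℕ => (p.2 : ℝ) / p.1) L (𝓝 θ) :=
    tendsto_comap.mono_left inf_le_right
  have hpos : ∀ᶠ p in L, 0 < p.1 := h₁.eventually_gt_atTop 0
  have h₂ : Tendsto (Prod.snd : ℕ × ℕ → ℕ) L atTop := by
    rw [← tendsto_natCast_atTop_iff (R := ℝ)]
    refine (hq.pos_mul_atTop hθ (tendsto_natCast_atTop_atTop.comp h₁)).congr' ?_
    filter_upwards [hpos] with p hp
    have : (p.1 : ℝ) ≠ 0 := by positivity
    simp [this]
  have hlim : Tendsto (fun p : ℕ × ℕ => (p.2.choose r : ℝ) / p.1.choose r) L (𝓝 (θ ^ r)) := by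
    have h := (((tendsto_choose_div_pow r).comp h₂).div ((tendsto_choose_div_pow r).comp h₁)
      (by positivity)).mul (hq.pow r)
    rw [div_self (by positivity), one_mul] at h
    refine h.congr' ?_
    filter_upwards [hpos, h₂.eventually_gt_atTop 0] with p hp hp'
    have : (p.1 : ℝ) ≠ 0 := by positivity
    have : (p.2 : ℝ) ≠ 0 := by positivity
    simp only [Function.comp_apply, Pi.div_apply, div_pow]
    field_simp
  have hev := hlim (Metric.closedBall_mem_nhds (θ ^ r) hε)
  obtain ⟨⟨N, δ⟩, ⟨-, hδ⟩, hsub⟩ :=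
    ((atTop_basis.comap Prod.fst).inf (Metric.nhds_basis_closedBall.comap _)).mem_iff.1 hev
  refine ⟨δ, hδ, max (max N 1) r, fun n hn x hx => ?_⟩
  have hn₁ : N ≤ n := by omega
  have hn₂ : 0 < (n : ℝ) := by exact_mod_cast (by omega : 0 < n)
  have hc : 0 < (n.choose r : ℝ) := by exact_mod_cast Nat.choose_pos (by omega)
  have hmem : (n, x) ∈ Prod.fst ⁻¹' Set.Ici N ∩
      (fun p : ℕ × ℕ => (p.2 : ℝ) / p.1) ⁻¹' Metric.closedBall θ δ := by
    refine ⟨hn₁, ?_⟩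
    rw [Set.mem_preimage, Metric.mem_closedBall, Real.dist_eq, div_sub' hn₂.ne', abs_div,
      abs_of_pos hn₂, div_le_iff₀ hn₂]
    rwa [mul_comm (n : ℝ)]
  have := hsub hmem
  rw [Set.mem_preimage, Metric.mem_closedBall, Real.dist_eq, div_sub' hc.ne', abs_div,
    abs_of_pos hc, div_le_iff₀ hc] at this
  rwa [mul_comm _ (n.choose r : ℝ)]

end Binomials

section CommonNeighbours

/-- The `(k-1)`-sets `J` that could contribute to the joint degree of `u` and `v` in a `k`-graph
with bipartition `X, Y`. -/
def jointCandidates (n k : ℕ) (X Y : Finset (Fin n)) (u v : Fin n) : Finset (Finset (Fin n)) :=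
  {J ∈ (univ \ {u, v}).powersetCard (k - 1) |
    insert u J ∈ crossing n k X Y ∧ insert v J ∈ crossing n k X Y}

variable {n k : ℕ} {X Y : Finset (Fin n)} {u v : Fin n}

theorem notMem_of_mem_jointCandidates {J : Finset (Fin n)}
    (hJ : J ∈ jointCandidates n k X Y u v) : u ∉ J ∧ v ∉ J := by
  have h := (mem_powersetCard.1 (mem_filter.1 hJ).1).1
  exact ⟨fun hu => by simpa using h hu, fun hv => by simpa using h hv⟩

theorem jointDeg_eq_card_jointCandidates {H : Finset (Finset (Fin n))}
    (hH : H ⊆ crossing n k X Y) :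
    jointDeg n k H u v = #{J ∈ jointCandidates n k X Y u v | insert u J ∈ H ∧ insert v J ∈ H} := by
  rw [jointDeg, jointCandidates, filter_filter]
  congr 1
  refine filter_congr fun J _ => ⟨fun h => ⟨⟨hH h.1, hH h.2⟩, h⟩, fun h => h.2⟩

theorem card_jointDeg_deviation_le (X Y : Finset (Fin n)) (huv : u ≠ v) {l t : ℝ} (hl₀ : 0 ≤ l)
    (hl₁ : l ≤ 1) :
    (#{H ∈ (crossing n k X Y).powerset |
      t < |(jointDeg n k H u v : ℝ) - #(jointCandidates n k X Y u v) / 4|} : ℝ) ≤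
      2 * Real.exp (l ^ 2 * #(jointCandidates n k X Y u v) / 4 - l * t) *
        2 ^ #(crossing n k X Y) := by
  have inj : ∀ w, (∀ J ∈ jointCandidates n k X Y u v, w ∉ J) →
      Set.InjOn (fun J => insert w J) (jointCandidates n k X Y u v : Set (Finset (Fin n))) := by
    intro w hw J hJ J' hJ' h
    rw [← erase_insert (hw J hJ), ← erase_insert (hw J' hJ')]
    exact congrArg (fun s => s.erase w) h
  convert card_filter_pairs_deviation_le (jointCandidates n k X Y u v) (fun J => insert u J)
    (fun J => insert v J) (crossing n k X Y) (fun J hJ => (mem_filter.1 hJ).2)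
    (inj u fun J hJ => (notMem_of_mem_jointCandidates hJ).1)
    (inj v fun J hJ => (notMem_of_mem_jointCandidates hJ).2) ?_ hl₀ hl₁ using 3
  · refine filter_congr fun H hH => ?_
    rw [jointDeg_eq_card_jointCandidates (mem_powerset.1 hH)]
  · intro J hJ J' hJ' h
    have hu : u ∈ insert v J' := h ▸ mem_insert_self u J
    rcases mem_insert.1 hu with hu | hu
    · exact huv hu
    · exact (notMem_of_mem_jointCandidates hJ').1 hu

theorem crossing_comm (n k : ℕ) (X Y : Finset (Fin n)) : crossing n k X Y = crossing n k Y X := by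
  simp only [crossing, and_comm]

theorem jointCandidates_comm_parts (n k : ℕ) (X Y : Finset (Fin n)) (u v : Fin n) :
    jointCandidates n k X Y u v = jointCandidates n k Y X u v := by
  simp only [jointCandidates, crossing_comm n k X Y]

theorem jointCandidates_comm_vertices (n k : ℕ) (X Y : Finset (Fin n)) (u v : Fin n) :
    jointCandidates n k X Y u v = jointCandidates n k X Y v u := by
  simp only [jointCandidates, and_comm, pair_comm]

theorem insert_mem_crossing (hk : 1 ≤ k) {J : Finset (Fin n)} {w : Fin n} (hw : w ∉ J)
    (hJ : #J = k - 1) : insert w J ∈ crossing n k X Y ↔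
      (w ∈ X → ¬ J ⊆ X) ∧ (w ∈ Y → ¬ J ⊆ Y) := by
  have : #(insert w J) = k := by rw [card_insert_of_notMem hw]; omega
  simp [crossing, this, insert_subset_iff]

theorem card_jointCandidates_le : #(jointCandidates n k X Y u v) ≤ n.choose (k - 1) :=
  (card_filter_le _ _).trans <| by
    rw [card_powersetCard]
    exact Nat.choose_le_choose _ ((card_le_univ _).trans (by simp))

theorem card_univ_sdiff_pair (huv : u ≠ v) : #(univ \ {u, v} : Finset (Fin n)) = n - 2 := by
  rw [card_sdiff_of_subset (subset_univ _), card_pair huv]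
  simp

theorem card_jointCandidates_of_mem_same (hk : 1 ≤ k) (hd : Disjoint X Y) (huv : u ≠ v)
    (hu : u ∈ X) (hv : v ∈ X) :
    #(jointCandidates n k X Y u v) + (#X - 2).choose (k - 1) = (n - 2).choose (k - 1) := by
  have huY : u ∉ Y := disjoint_left.1 hd hu
  have hvY : v ∉ Y := disjoint_left.1 hd hv
  have h₁ : jointCandidates n k X Y u v =
      {J ∈ (univ \ {u, v}).powersetCard (k - 1) | ¬ J ⊆ X} := by
    refine filter_congr fun J hJ => ?_
    obtain ⟨hJs, hJc⟩ := mem_powersetCard.1 hJ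
    rw [insert_mem_crossing hk (fun h => by simpa using hJs h) hJc,
      insert_mem_crossing hk (fun h => by simpa using hJs h) hJc]
    simp [hu, hv, huY, hvY]
  have h₂ : {J ∈ (univ \ {u, v} : Finset (Fin n)).powersetCard (k - 1) | J ⊆ X} =
      (X \ {u, v}).powersetCard (k - 1) := by
    ext J
    simp only [mem_filter, mem_powersetCard, subset_sdiff, subset_univ, true_and]
    tauto
  have h₃ : #(X \ {u, v}) = #X - 2 := by
    rw [card_sdiff_of_subset (by simp [insert_subset_iff, hu, hv]), card_pair huv]
  rw [h₁, ← h₃, ← card_powersetCard, ← h₂, ← card_univ_sdiff_pair huv, ← card_powersetCard,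
    add_comm, card_filter_add_card_filter_not]

theorem card_jointCandidates_of_mem_distinct (hk : 2 ≤ k) (hd : Disjoint X Y) (hu : u ∈ X)
    (hv : v ∈ Y) :
    #(jointCandidates n k X Y u v) + ((#X - 1).choose (k - 1) + (#Y - 1).choose (k - 1)) =
      (n - 2).choose (k - 1) := by
  have huY : u ∉ Y := disjoint_left.1 hd hu
  have hvX : v ∉ X := disjoint_right.1 hd hv
  have huv : u ≠ v := fun h => huY (h ▸ hv)
  have h₁ : jointCandidates n k X Y u v =
      {J ∈ (univ \ {u, v}).powersetCard (k - 1) | ¬ (J ⊆ X ∨ J ⊆ Y)} := by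
    refine filter_congr fun J hJ => ?_
    obtain ⟨hJs, hJc⟩ := mem_powersetCard.1 hJ
    rw [insert_mem_crossing (by omega) (fun h => by simpa using hJs h) hJc,
      insert_mem_crossing (by omega) (fun h => by simpa using hJs h) hJc]
    simp [hu, hv, huY, hvX]
  have h₂ : {J ∈ (univ \ {u, v} : Finset (Fin n)).powersetCard (k - 1) | J ⊆ X} =
      (X.erase u).powersetCard (k - 1) := by
    ext J
    have : J ⊆ X → v ∉ J := fun h hJ => hvX (h hJ)
    simp only [mem_filter, mem_powersetCard, subset_sdiff, subset_univ, true_and, subset_erase,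
      disjoint_insert_right, disjoint_singleton_right]
    tauto
  have h₃ : {J ∈ (univ \ {u, v} : Finset (Fin n)).powersetCard (k - 1) | J ⊆ Y} =
      (Y.erase v).powersetCard (k - 1) := by
    ext J
    have : J ⊆ Y → u ∉ J := fun h hJ => huY (h hJ)
    simp only [mem_filter, mem_powersetCard, subset_sdiff, subset_univ, true_and, subset_erase,
      disjoint_insert_right, disjoint_singleton_right]
    tauto
  have h₄ : Disjoint {J ∈ (univ \ {u, v} : Finset (Fin n)).powersetCard (k - 1) | J ⊆ X}
      {J ∈ (univ \ {u, v} : Finset (Fin n)).powersetCard (k - 1) | J ⊆ Y} := by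
    refine disjoint_filter.2 fun J hJ hX hY => ?_
    have hJ₀ : J = ∅ := by simpa using hd hX hY
    have := (mem_powersetCard.1 hJ).2
    rw [hJ₀, card_empty] at this
    omega
  rw [h₁, ← card_erase_of_mem hu, ← card_erase_of_mem hv, ← card_powersetCard, ← card_powersetCard,
    ← h₂, ← h₃, ← card_union_of_disjoint h₄, ← filter_or, ← card_univ_sdiff_pair huv,
    ← card_powersetCard, add_comm, card_filter_add_card_filter_not]

/-- The number of sets that a bipartition predicts to be potential common neighbours of `u` and `v`,
as a fraction of `C(n, k-1)`. -/
noncomputable def jointFraction (k : ℕ) (X Y : Finset (Fin n)) (u v : Fin n) : ℝ :=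
  if (u ∈ X ∧ v ∈ X) ∨ (u ∈ Y ∧ v ∈ Y) then 1 - (2 : ℝ) ^ (1 - (k : ℤ))
  else 1 - (2 : ℝ) ^ (2 - (k : ℤ))

theorem exists_lt_of_not_sigmaStandardWrt {σ : ℝ} {H : Finset (Finset (Fin n))}
    (h : ¬ SigmaStandardWrt n k σ H X Y) :
    ∃ u v : Fin n, u ≠ v ∧ σ * ((1 / 4 : ℝ) * n.choose (k - 1)) <
      |(jointDeg n k H u v : ℝ) - 1 / 4 * n.choose (k - 1) * jointFraction k X Y u v| := by
  contrapose! h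
  intro u v huv
  have := h u v huv
  unfold jointFraction at this
  exact ⟨fun hs => by rwa [if_pos hs] at this, fun hs => by rwa [if_neg hs] at this⟩

end CommonNeighbours

/-- In a nearly balanced bipartition the number of candidate sets is close to its predicted
value. -/
theorem exists_card_jointCandidates_near {k : ℕ} (hk : 2 ≤ k) {ε : ℝ} (hε : 0 < ε) :
    ∃ γ : ℝ, 0 < γ ∧ γ < 1 ∧ ∃ N : ℕ, ∀ n ≥ N, ∀ X Y : Finset (Fin n), Disjoint X Y →
      X ∪ Y = univ → |(#X : ℝ) - 1 / 2 * n| ≤ γ * n → |(#Y : ℝ) - 1 / 2 * n| ≤ γ * n →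
      ∀ u v : Fin n, u ≠ v →
      |(#(jointCandidates n k X Y u v) : ℝ) - n.choose (k - 1) * jointFraction k X Y u v| ≤
        ε * n.choose (k - 1) := by
  obtain ⟨δ₁, hδ₁, N₁, h₁⟩ := exists_choose_near (k - 1) one_pos (by positivity : 0 < ε / 3)
  obtain ⟨δ₂, hδ₂, N₂, h₂⟩ := exists_choose_near (k - 1) one_half_pos (by positivity : 0 < ε / 3)
  obtain ⟨N₃, hN₃⟩ := exists_nat_ge (2 / δ₁)
  obtain ⟨N₄, hN₄⟩ := exists_nat_ge (4 / δ₂)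
  refine ⟨min (δ₂ / 2) (1 / 2), by positivity, by
    linarith [min_le_right (δ₂ / 2) (1 / 2 : ℝ)], max (max N₁ N₂) (max (max N₃ N₄) 2), ?_⟩
  intro n hn
  have hn₁ : N₁ ≤ n := by omega
  have hn₂ : N₂ ≤ n := by omega
  have hn₃ : 2 ≤ δ₁ * n := by
    rw [← div_le_iff₀' hδ₁]
    exact hN₃.trans (by exact_mod_cast (by omega : N₃ ≤ n))
  have hn₄ : 4 ≤ δ₂ * n := by
    rw [← div_le_iff₀' hδ₂]
    exact hN₄.trans (by exact_mod_cast (by omega : N₄ ≤ n))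
  have htotal := h₁ n hn₁ (n - 2) (by
    rw [Nat.cast_sub (by omega), abs_le]
    push_cast
    constructor <;> linarith)
  have hpart : ∀ x d : ℕ, d ≤ 2 → |(x : ℝ) - 1 / 2 * n| ≤ min (δ₂ / 2) (1 / 2) * n →
      |((x - d).choose (k - 1) : ℝ) - (1 / 2) ^ (k - 1) * n.choose (k - 1)| ≤
        ε / 3 * n.choose (k - 1) := by
    intro x d hd hx
    refine h₂ n hn₂ (x - d) ?_
    have hd' : (d : ℝ) ≤ 2 := by exact_mod_cast hd
    have hlow : (x : ℝ) ≤ (x - d : ℕ) + d := by exact_mod_cast (by omega : x ≤ (x - d) + d)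
    have hup : ((x - d : ℕ) : ℝ) ≤ x := by exact_mod_cast Nat.sub_le x d
    have hmin : min (δ₂ / 2) (1 / 2) * (n : ℝ) ≤ δ₂ / 2 * n := by gcongr; exact min_le_left _ _
    rw [abs_le] at hx ⊢
    constructor <;> linarith [hx.1, hx.2]
  have hpow₁ : (2 : ℝ) ^ (1 - (k : ℤ)) = (1 / 2) ^ (k - 1) := by
    rw [one_div, inv_pow, ← zpow_natCast, ← zpow_neg]
    congr 1
    omega
  have hpow₂ : (2 : ℝ) ^ (2 - (k : ℤ)) = 2 * (1 / 2) ^ (k - 1) := by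
    rw [← hpow₁, ← zpow_one_add₀ (by norm_num)]
    congr 1
    ring
  have hsame : ∀ X Y : Finset (Fin n), Disjoint X Y →
      |(#X : ℝ) - 1 / 2 * n| ≤ min (δ₂ / 2) (1 / 2) * n → ∀ u v : Fin n, u ≠ v → u ∈ X → v ∈ X →
      |(#(jointCandidates n k X Y u v) : ℝ) - n.choose (k - 1) * (1 - (2 : ℝ) ^ (1 - (k : ℤ)))| ≤
        ε * n.choose (k - 1) := by
    intro X Y hd hX u v huv hu hv
    have heq : (#(jointCandidates n k X Y u v) : ℝ) + ((#X - 2).choose (k - 1) : ℕ) =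
        ((n - 2).choose (k - 1) : ℕ) := by
      exact_mod_cast card_jointCandidates_of_mem_same (by omega) hd huv hu hv
    have hp := hpart #X 2 le_rfl hX
    have hc : (0 : ℝ) ≤ ε * n.choose (k - 1) := by positivity
    rw [hpow₁]
    rw [one_pow, one_mul] at htotal
    rw [abs_le] at *
    constructor <;> linarith [htotal.1, htotal.2, hp.1, hp.2]
  have hdistinct : ∀ X Y : Finset (Fin n), Disjoint X Y →
      |(#X : ℝ) - 1 / 2 * n| ≤ min (δ₂ / 2) (1 / 2) * n →
      |(#Y : ℝ) - 1 / 2 * n| ≤ min (δ₂ / 2) (1 / 2) * n → ∀ u v : Fin n, u ∈ X → v ∈ Y →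
      |(#(jointCandidates n k X Y u v) : ℝ) - n.choose (k - 1) * (1 - (2 : ℝ) ^ (2 - (k : ℤ)))| ≤
        ε * n.choose (k - 1) := by
    intro X Y hd hX hY u v hu hv
    have heq : (#(jointCandidates n k X Y u v) : ℝ) +
        (((#X - 1).choose (k - 1) : ℕ) + ((#Y - 1).choose (k - 1) : ℕ)) =
        ((n - 2).choose (k - 1) : ℕ) := by
      exact_mod_cast card_jointCandidates_of_mem_distinct hk hd hu hv
    have hp := hpart #X 1 (by norm_num) hX
    have hq := hpart #Y 1 (by norm_num) hY
    rw [hpow₂]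
    rw [one_pow, one_mul] at htotal
    rw [abs_le] at *
    constructor <;> linarith [htotal.1, htotal.2, hp.1, hp.2, hq.1, hq.2]
  intro X Y hd hXY hX hY u v huv
  have hmem : ∀ w, w ∈ X ∨ w ∈ Y := fun w => mem_union.1 (hXY ▸ mem_univ w)
  unfold jointFraction
  rcases hmem u with hu | hu <;> rcases hmem v with hv | hv
  · rw [if_pos (by simp [hu, hv])]
    exact hsame X Y hd hX u v huv hu hv
  · rw [if_neg (by simp [disjoint_left.1 hd hu, disjoint_right.1 hd hv])]
    exact hdistinct X Y hd hX hY u v hu hv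
  · rw [if_neg (by simp [disjoint_left.1 hd hv, disjoint_right.1 hd hu]),
      jointCandidates_comm_vertices]
    exact hdistinct X Y hd hX hY v u hv hu
  · rw [if_pos (by simp [hu, hv]), jointCandidates_comm_parts]
    exact hsame Y X hd.symm hY u v huv hu hv

theorem subset_crossing_of_isBipartition {n k : ℕ} {H : Finset (Finset (Fin n))}
    {X Y : Finset (Fin n)} (hH : IsKGraph n k H) (h : IsBipartition n H X Y) :
    H ⊆ crossing n k X Y := fun e he =>
  mem_filter.2 ⟨mem_powersetCard.2 ⟨subset_univ _, hH e he⟩, h.2.2 e he⟩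

theorem two_pow_card_crossing_le_ncard_bip {n k : ℕ} {X Y : Finset (Fin n)} (hd : Disjoint X Y)
    (hXY : X ∪ Y = univ) : 2 ^ #(crossing n k X Y) ≤ (Bip n k).ncard := by
  rw [← card_powerset, ← Set.ncard_coe_finset]
  refine Set.ncard_le_ncard (fun H hH => ?_) (Set.toFinite _)
  have hsub : H ⊆ crossing n k X Y := mem_powerset.1 hH
  exact ⟨fun e he => (mem_powersetCard.1 (mem_filter.1 (hsub he)).1).2, X, Y, hd, hXY,
    fun e he => (mem_filter.1 (hsub he)).2⟩

/-- The exponential tail `exp (-b C(n, r))` absorbs the union bound when `r ≥ 2`. -/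
theorem exists_union_bound_le {r : ℕ} (hr : 2 ≤ r) {b : ℝ} (hb : 0 < b) :
    ∃ c : ℝ, 0 < c ∧ ∃ N : ℕ, ∀ n ≥ N,
      2 ^ n * (n : ℝ) ^ 2 * (2 * Real.exp (-(b * n.choose r))) ≤
        (2 : ℝ) ^ (-(c * (n : ℝ) ^ r)) := by
  set a : ℝ := b * (1 / 2 * (1 / (r.factorial : ℝ))) with ha
  have ha₀ : 0 < a := by positivity
  obtain ⟨N₁, hN₁⟩ := Filter.eventually_atTop.1
    ((tendsto_choose_div_pow r).eventually_const_le
      (show 1 / 2 * (1 / (r.factorial : ℝ)) < 1 / (r.factorial : ℝ) by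
        have : 0 < 1 / (r.factorial : ℝ) := by positivity
        linarith))
  obtain ⟨N₂, hN₂⟩ := exists_nat_ge (4 / (a / 2))
  refine ⟨a / 2, by positivity, max (max N₁ N₂) 1, fun n hn => ?_⟩
  have hn₁ : (1 : ℝ) ≤ n := by exact_mod_cast (by omega : 1 ≤ n)
  have hchoose : a * (n : ℝ) ^ r ≤ b * n.choose r := by
    have := hN₁ n (by omega)
    rw [le_div_iff₀ (by positivity)] at this
    rw [ha, mul_assoc]
    gcongr
  have hlin : 4 * (n : ℝ) ≤ a / 2 * n ^ r := by
    have h₁ : 4 ≤ a / 2 * n := by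
      rw [← div_le_iff₀' (by positivity)]
      exact hN₂.trans (by exact_mod_cast (by omega : N₂ ≤ n))
    calc 4 * (n : ℝ) ≤ a / 2 * n * n := by gcongr
      _ = a / 2 * n ^ 2 := by ring
      _ ≤ a / 2 * n ^ r := by gcongr
  have htwo : (2 : ℝ) ≤ Real.exp 1 := by linarith [Real.add_one_le_exp (1 : ℝ)]
  have hself : (n : ℝ) ≤ Real.exp n := by linarith [Real.add_one_le_exp (n : ℝ)]
  have htwo_n : (2 : ℝ) ≤ Real.exp n := htwo.trans (Real.exp_le_exp.2 hn₁)
  have hpow : (2 : ℝ) ^ n ≤ Real.exp n := by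
    rw [← Real.exp_one_pow]
    gcongr
  calc 2 ^ n * (n : ℝ) ^ 2 * (2 * Real.exp (-(b * n.choose r)))
      ≤ Real.exp n * Real.exp n ^ 2 * (Real.exp n * Real.exp (-(a * (n : ℝ) ^ r))) := by gcongr
    _ = Real.exp (4 * n - a * (n : ℝ) ^ r) := by
        rw [← Real.exp_nat_mul, ← Real.exp_add, ← Real.exp_add, ← Real.exp_add]
        congr 1
        push_cast
        ring
    _ ≤ Real.exp (-(a / 2 * (n : ℝ) ^ r)) := Real.exp_le_exp.2 (by linarith)
    _ ≤ (2 : ℝ) ^ (-(a / 2 * (n : ℝ) ^ r)) := by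
        rw [Real.rpow_def_of_pos two_pos]
        refine Real.exp_le_exp.2 ?_
        have hlog : Real.log 2 ≤ 1 := (Real.log_le_iff_le_exp two_pos).2 htwo
        have : 0 ≤ a / 2 * (n : ℝ) ^ r := by positivity
        nlinarith

theorem stmt5 (k : ℕ) (hk : 3 ≤ k) (σ : ℝ) (hσ0 : 0 < σ) (hσ1 : σ < (2 : ℝ) ^ (-(k : ℤ))) :
    ∃ γ : ℝ, 0 < γ ∧ γ < 1 ∧ ∃ c : ℝ, 0 < c ∧ ∃ N : ℕ, ∀ n : ℕ, N ≤ n →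
      (({H ∈ Bip n k | GammaEquitable n γ H ∧ ¬ SigmaStandard n k σ H}.ncard : ℝ))
        ≤ ((Bip n k).ncard : ℝ) * (2 : ℝ) ^ (-(c * (n : ℝ) ^ (k - 1))) := by
  have hσ : σ ≤ 1 := hσ1.le.trans (zpow_le_one_of_nonpos₀ (by norm_num) (by omega))
  obtain ⟨γ, hγ₀, hγ₁, N₁, hnear⟩ :=
    exists_card_jointCandidates_near (by omega : 2 ≤ k) (half_pos hσ0)
  obtain ⟨c, hc, N₂, hunion⟩ :=
    exists_union_bound_le (by omega : 2 ≤ k - 1) (by positivity : 0 < σ ^ 2 / 64)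
  refine ⟨γ, hγ₀, hγ₁, c, hc, max N₁ N₂, fun n hn => ?_⟩
  set C : ℝ := ((n.choose (k - 1) : ℕ) : ℝ) with hC
  have hC₀ : 0 ≤ C := by positivity
  set bad : Finset (Fin n) × Fin n × Fin n → Finset (Finset (Finset (Fin n))) := fun p =>
    {H ∈ (crossing n k p.1 p.1ᶜ).powerset | σ * C / 8 <
      |(jointDeg n k H p.2.1 p.2.2 : ℝ) - #(jointCandidates n k p.1 p.1ᶜ p.2.1 p.2.2) / 4|}
  set I : Finset (Finset (Fin n) × Fin n × Fin n) := {p | p.2.1 ≠ p.2.2} with hI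
  have hsub : {H ∈ Bip n k | GammaEquitable n γ H ∧ ¬ SigmaStandard n k σ H} ⊆
      (I.biUnion bad : Set (Finset (Finset (Fin n)))) := by
    rintro H ⟨⟨hH, -⟩, hequi, hstd⟩
    simp only [SigmaStandard, not_forall] at hstd
    obtain ⟨X, Y, hXY, hstd⟩ := hstd
    obtain ⟨u, v, huv, hdev⟩ := exists_lt_of_not_sigmaStandardWrt hstd
    obtain ⟨⟨hX₁, hX₂⟩, hY₁, hY₂⟩ := hequi X Y hXY
    have hγn : 0 ≤ γ * (n : ℝ) := by positivity
    have hclose := hnear n (by omega) X Y hXY.1 hXY.2.1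
      (abs_le.2 ⟨by linarith, by linarith⟩) (abs_le.2 ⟨by linarith, by linarith⟩) u v huv
    have hY : Y = Xᶜ := (IsCompl.compl_eq ⟨hXY.1, codisjoint_iff.2 hXY.2.1⟩).symm
    have hsubset := subset_crossing_of_isBipartition hH hXY
    subst hY
    refine mem_coe.2 (mem_biUnion.2 ⟨(X, u, v), by simpa [hI] using huv,
      mem_filter.2 ⟨mem_powerset.2 hsubset, ?_⟩⟩)
    rw [← hC] at hdev hclose
    rw [abs_le] at hclose
    rw [lt_abs] at hdev ⊢
    dsimp only
    rcases hdev with h | h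
    · left; linarith [hclose.1, hclose.2]
    · right; linarith [hclose.1, hclose.2]
  have hterm : ∀ p ∈ I, (#(bad p) : ℝ) ≤
      2 * Real.exp (-(σ ^ 2 / 64 * C)) * (Bip n k).ncard := by
    rintro ⟨X, u, v⟩ hp
    have huv : u ≠ v := by simpa [hI] using hp
    have hcard : (2 : ℝ) ^ #(crossing n k X Xᶜ) ≤ (Bip n k).ncard := by
      exact_mod_cast two_pow_card_crossing_le_ncard_bip disjoint_compl_right (union_compl X)
    have hm : (#(jointCandidates n k X Xᶜ u v) : ℝ) ≤ C := by
      rw [hC]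
      exact_mod_cast card_jointCandidates_le
    refine (card_jointDeg_deviation_le X Xᶜ huv (l := σ / 4) (by positivity)
      (by linarith)).trans ?_
    gcongr
    nlinarith [mul_le_mul_of_nonneg_left hm (sq_nonneg σ)]
  have hI_card : (#I : ℝ) ≤ 2 ^ n * (n : ℝ) ^ 2 := by
    have : #I ≤ 2 ^ n * n ^ 2 := (card_le_univ _).trans (by simp [sq])
    exact_mod_cast this
  calc (({H ∈ Bip n k | GammaEquitable n γ H ∧ ¬ SigmaStandard n k σ H}.ncard : ℝ))
      ≤ (#(I.biUnion bad) : ℝ) := by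
        rw [← Set.ncard_coe_finset]
        exact_mod_cast Set.ncard_le_ncard hsub (Set.toFinite _)
    _ ≤ ∑ p ∈ I, (#(bad p) : ℝ) := by exact_mod_cast card_biUnion_le
    _ ≤ #I * (2 * Real.exp (-(σ ^ 2 / 64 * C)) * (Bip n k).ncard) := by
        rw [← nsmul_eq_mul]
        exact sum_le_card_nsmul _ _ _ hterm
    _ ≤ 2 ^ n * (n : ℝ) ^ 2 * (2 * Real.exp (-(σ ^ 2 / 64 * C)) * (Bip n k).ncard) := by gcongr
    _ = (Bip n k).ncard * (2 ^ n * (n : ℝ) ^ 2 * (2 * Real.exp (-(σ ^ 2 / 64 * C)))) := by ring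
    _ ≤ _ := by
        gcongr
        exact hunion n (by omega)
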